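/- Let f be a probability density on ℝ^q such that ∫_{ℝ^q} |𝓕f(u)|^{2−a} du < ∞ for some a ∈ (0,1), and let K : ℝ^q → ℝ be continuous, bounded and integrable with 𝓕K integrable. Then there exists a constant C < ∞, depending only on f, K, q and a, such that for every t ∈ ℝ^q and every h > 0: h^{−q} | ∫_{ℝ^q} K((t−x)/h) f(x) dx | ≤ C h^{−q(1−a)/(2−a)}. -/

import Mathlib

/- STATEMENT 11: uniform kernel-density bound: if `∫|𝓕f|^{2−a} < ∞` with
`a ∈ (0,1)` and `K` is continuous, bounded, integrable with integrable Fourier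
transform, then `h^{−q} |∫ K((t−x)/h) f(x) dx| ≤ C h^{−q(1−a)/(2−a)}` for all
`t ∈ ℝ^q`, `h > 0`, with a constant `C` independent of `t` and `h`. -/

open MeasureTheory Filter
open scoped ENNReal NNReal Topology

noncomputable section

/-- Fourier transform (convention `∫ e^{-2πi u·x} f(x) dx`) of a real function on `ℝ^q`. -/
noncomputable def FTq {q : ℕ} (f : EuclideanSpace ℝ (Fin q) → ℝ) :
    EuclideanSpace ℝ (Fin q) → ℂ :=
  FourierTransform.fourier (fun x => (f x : ℂ))

open scoped FourierTransform RealInnerProductSpace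

section FourierKernel

variable {V : Type*} [NormedAddCommGroup V] [InnerProductSpace ℝ V] [MeasurableSpace V]
  [BorelSpace V] [FiniteDimensional ℝ V]

theorem norm_fourier_le_integral_norm (g : V → ℂ) (u : V) : ‖𝓕 g u‖ ≤ ∫ x, ‖g x‖ :=
  VectorFourier.norm_fourierIntegral_le_integral_norm _ _ _ _ _

theorem continuous_fourier_of_integrable {g : V → ℂ} (hg : Integrable g) : Continuous (𝓕 g) :=
  VectorFourier.fourierIntegral_continuous Real.continuous_fourierChar
    (by exact continuous_inner) hg

/-- An integrable bounded function lies in every `L^p` with `1 ≤ p < ∞`. -/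
theorem MeasureTheory.Integrable.memLp_ofReal_of_bound {α E : Type*} [MeasurableSpace α]
    [NormedAddCommGroup E] {μ : Measure α} {g : α → E} (hg : Integrable g μ) {M : ℝ}
    (hM : ∀ x, ‖g x‖ ≤ M) {p : ℝ} (hp : 1 ≤ p) : MemLp g (ENNReal.ofReal p) μ := by
  rw [← integrable_norm_rpow_iff hg.1 (by simp; linarith) (by simp),
    ENNReal.toReal_ofReal (by linarith)]
  refine (hg.norm.const_mul (M ^ (p - 1))).mono'
    (hg.1.norm.aemeasurable.pow_const p).aestronglyMeasurable (Eventually.of_forall fun x => ?_)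
  rw [Real.norm_of_nonneg (by positivity)]
  have h : ‖g x‖ ^ p = ‖g x‖ ^ (p - 1) * ‖g x‖ := by
    rw [← Real.rpow_add_one' (norm_nonneg _) (by linarith), sub_add_cancel]
  rw [h]
  exact mul_le_mul_of_nonneg_right
    (Real.rpow_le_rpow (norm_nonneg _) (hM x) (by linarith)) (norm_nonneg _)

/-- Parseval-type formula for the smoothing of `g` by a rescaled kernel `k`. -/
theorem integral_comp_smul_sub_mul_eq {k g : V → ℂ} (hkc : Continuous k) (hk : Integrable k)
    (hkF : Integrable (𝓕 k)) (hg : Integrable g) (c : ℝ) (t : V) :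
    ∫ x, k (c • (t - x)) * g x =
      ∫ u, (Real.fourierChar ⟪u, c • t⟫ • 𝓕 k u) * 𝓕 g (c • u) := by
  have hG : Integrable (fun u => Real.fourierChar ⟪u, c • t⟫ • 𝓕 k u) := by
    simpa [inner_neg_right] using (Real.fourierIntegral_convergent_iff (-(c • t))).2 hkF
  have key := VectorFourier.integral_fourierIntegral_smul_eq_flip (μ := (volume : Measure V))
    (ν := (volume : Measure V)) (L := c • innerₗ V) Real.continuous_fourierChar
    (by simp only [LinearMap.smul_apply, innerₗ_apply_apply]; fun_prop) hG hg
  have hL : ∀ x, VectorFourier.fourierIntegral Real.fourierChar volume (c • innerₗ V)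
      (fun u => Real.fourierChar ⟪u, c • t⟫ • 𝓕 k u) x = k (c • (t - x)) := by
    intro x
    conv_rhs => rw [← hkc.fourierInv_fourier_eq hk hkF, Real.fourierInv_eq]
    refine integral_congr_ae (Eventually.of_forall fun u => ?_)
    simp only [smul_smul, ← AddChar.map_add_eq_mul]
    congr 2
    simp [inner_sub_right, inner_smul_right]
    ring
  have hR : ∀ u, VectorFourier.fourierIntegral Real.fourierChar volume (c • innerₗ V).flip g u
      = 𝓕 g (c • u) := by
    intro u
    rw [Real.fourier_eq]
    refine integral_congr_ae (Eventually.of_forall fun x => ?_)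
    simp [inner_smul_right, real_inner_comm]
  simpa only [hL, hR, smul_eq_mul] using key

theorem norm_integral_comp_smul_sub_mul_le {k g : V → ℂ} (hkc : Continuous k)
    (hk : Integrable k) (hkF : Integrable (𝓕 k)) (hg : Integrable g) {p r : ℝ}
    (hpr : p.HolderConjugate r) (hgF : Integrable (fun u => ‖𝓕 g u‖ ^ r)) {h : ℝ} (hh : 0 < h)
    (t : V) :
    ‖∫ x, k (h⁻¹ • (t - x)) * g x‖ ≤
      (∫ u, ‖𝓕 k u‖ ^ p) ^ (1 / p) *
        (h ^ Module.finrank ℝ V * ∫ u, ‖𝓕 g u‖ ^ r) ^ (1 / r) := by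
  rw [integral_comp_smul_sub_mul_eq hkc hk hkF hg]
  refine (norm_integral_le_integral_norm _).trans ?_
  simp only [norm_mul, Circle.norm_smul]
  have hgm : MemLp (fun u => 𝓕 g (h⁻¹ • u)) (ENNReal.ofReal r) := by
    have hc : Continuous (fun u => 𝓕 g (h⁻¹ • u)) :=
      (continuous_fourier_of_integrable hg).comp (continuous_const_smul _)
    rw [← integrable_norm_rpow_iff hc.aestronglyMeasurable (by simpa using hpr.symm.pos) (by simp),
      ENNReal.toReal_ofReal hpr.symm.nonneg]
    exact hgF.comp_smul (inv_ne_zero hh.ne')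
  have hH := integral_mul_norm_le_Lp_mul_Lq hpr
    (hkF.memLp_ofReal_of_bound (norm_fourier_le_integral_norm k) hpr.lt.le) hgm
  rwa [Measure.integral_comp_inv_smul_of_nonneg volume (fun u => ‖𝓕 g u‖ ^ r) hh.le,
    smul_eq_mul] at hH

end FourierKernel

theorem stmt11
    {q : ℕ} (f K : EuclideanSpace ℝ (Fin q) → ℝ)
    -- f is a probability density
    (hfnonneg : ∀ x, 0 ≤ f x) (hfint : Integrable f) (hfone : ∫ x, f x = 1)
    {a : ℝ} (ha : a ∈ Set.Ioo (0 : ℝ) 1)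
    (hfF : Integrable (fun u => ‖FTq f u‖ ^ (2 - a)))
    (hKcont : Continuous K) (hKbdd : ∃ M, ∀ z, |K z| ≤ M) (hKint : Integrable K)
    (hKFint : Integrable (FTq K)) :
    ∃ C : ℝ, ∀ (t : EuclideanSpace ℝ (Fin q)) (h : ℝ), 0 < h →
      (h ^ q)⁻¹ * |∫ x, K (h⁻¹ • (t - x)) * f x| ≤
        C * h ^ (-(q : ℝ) * (1 - a) / (2 - a)) := by
  have hp : ((2 - a) / (1 - a)).HolderConjugate (2 - a) := by
    have h1 : 0 < 1 - a := by linarith [ha.2]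
    rw [Real.holderConjugate_iff]
    refine ⟨by rw [lt_div_iff₀ h1]; linarith, ?_⟩
    have h2 : 2 - a ≠ 0 := by linarith
    field_simp
    ring
  refine ⟨(∫ u, ‖FTq K u‖ ^ ((2 - a) / (1 - a))) ^ (1 / ((2 - a) / (1 - a))) *
    (∫ u, ‖FTq f u‖ ^ (2 - a)) ^ (1 / (2 - a)), fun t h hh => ?_⟩
  have key := norm_integral_comp_smul_sub_mul_le (k := fun x => (K x : ℂ))
    (g := fun x => (f x : ℂ)) (Complex.continuous_ofReal.comp hKcont)
    hKint.ofReal hKFint hfint.ofReal hp hfF hh t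
  have hcast : ∫ x, (K (h⁻¹ • (t - x)) : ℂ) * (f x : ℂ) =
      ((∫ x, K (h⁻¹ • (t - x)) * f x : ℝ) : ℂ) := by
    rw [← integral_complex_ofReal]
    simp
  have hpow : (h ^ q)⁻¹ * (h ^ q) ^ (1 / (2 - a)) = h ^ (-(q : ℝ) * (1 - a) / (2 - a)) := by
    rw [← Real.rpow_natCast, ← Real.rpow_neg hh.le, ← Real.rpow_mul hh.le, ← Real.rpow_add hh]
    congr 1
    have h2 : 2 - a ≠ 0 := by linarith [ha.2]
    field_simp
    ring
  rw [hcast, Complex.norm_real, Real.norm_eq_abs, finrank_euclideanSpace_fin,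
    Real.mul_rpow (by positivity) (by positivity)] at key
  calc _ ≤ (h ^ q)⁻¹ * _ := mul_le_mul_of_nonneg_left key (by positivity)
    _ = _ := by
      rw [← hpow]
      simp only [FTq]
      ring

end
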